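/- arXiv:1511.05215 — 3 statements merged into one kernel-verified Lean document; each statement's English description precedes it below -/
import Mathlib

section
/- For 0 ≤ n ≤ j, assuming (a+c)_n ≠ 0 and (a-c-j)_n ≠ 0, the odd-case monic para-Racah polynomial admits the explicit expression P_n(y) = η_n · Σ_{k=0}^{n} [(-n)_k (n-N)_k / ((1)_k (-j)_k (a+c)_k (a-c-j)_k)] · Φ_k(y), where Φ_k(y) = Π_{l=0}^{k-1} ((a+l)² + y) and η_n = (1)_n (-j)_n (a+c)_n (a-c-j)_n / ((-n)_n (n-N)_n). -/
open Filter Topology Polynomial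

noncomputable section

/-- The recurrence coefficient `bₙ` of the para-Racah polynomials, odd case `N = 2j+1`. -/
def bOdd (j : ℕ) (a c α : ℝ) (n : ℕ) : ℝ :=
  if n = j then
    -a ^ 2 - (j : ℝ) * (1 + a - c) * (1 + a + c + j) / 2 + α * (a - c) * (1 + (j : ℝ)) * (a + c + j)
  else if n = j + 1 then
    -a ^ 2 - (j : ℝ) * (1 + a - c) * (1 + a + c + j) / 2
      + (1 - α) * (a - c) * (1 + (j : ℝ)) * (a + c + j)
  else
    -(a * (a + j) + c * (c + j) + (n : ℝ) * ((2 * (j : ℝ) + 1) - n)) / 2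

/-- The recurrence coefficient `uₙ` of the para-Racah polynomials, odd case `N = 2j+1`. -/
def uOdd (j : ℕ) (a c α : ℝ) (n : ℕ) : ℝ :=
  if n = j + 1 then
    α * (1 - α) * (a - c) ^ 2 * (1 + (j : ℝ)) ^ 2 * (a + c + j) ^ 2
  else
    (n : ℝ) * ((2 * (j : ℝ) + 1) + 1 - n) * ((2 * (j : ℝ) + 1) - n + a + c) * ((n : ℝ) - 1 + a + c)
        * (((n : ℝ) - j - 1) ^ 2 - (a - c) ^ 2) /
      (4 * ((2 * (j : ℝ) + 1) - 2 * n) * ((2 * (j : ℝ) + 1) - 2 * n + 2))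

/-- Monic orthogonal polynomial sequence from a three-term recurrence:
`monicOPS b u n = (P_{n-1}, P_n)` with `P₋₁ = 0`, `P₀ = 1`,
`P_{n+1}(y) = (y - bₙ) Pₙ(y) - uₙ P_{n-1}(y)`. -/
def monicOPS (b u : ℕ → ℝ) : ℕ → Polynomial ℝ × Polynomial ℝ
  | 0 => (0, 1)
  | n + 1 =>
    ((monicOPS b u n).2,
      (X - C (b n)) * (monicOPS b u n).2 - C (u n) * (monicOPS b u n).1)

/-- The monic para-Racah polynomial `Pₙ`, odd case `N = 2j+1`. -/
def paraRacahOdd (j : ℕ) (a c α : ℝ) (n : ℕ) : Polynomial ℝ :=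
  (monicOPS (bOdd j a c α) (uOdd j a c α) n).2

/-- The Pochhammer symbol `(z)ₖ = z (z+1) ⋯ (z+k-1)`. -/
def poch (z : ℝ) (k : ℕ) : ℝ := ∏ i ∈ Finset.range k, (z + i)

/-- The product of the three linear lower-parameter factors. -/
def qf (j a c x : ℝ) : ℝ := (x - j) * (a + c + x) * (a - c - j + x)

/-- The coefficient of `Φ_k` in `P_{k+m}`, defined recursively in `m`. -/
def Sc (j a c : ℝ) (k : ℕ) : ℕ → ℝ
  | 0 => 1
  | m + 1 => -(Sc j a c k m) * (k + m + 1) / (m + 1) * qf j a c (k + m) * (2 * k + m - (2 * j + 1))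
      / ((2 * k + 2 * m - (2 * j + 1)) * (2 * k + 2 * m + 1 - (2 * j + 1)))

lemma Sc_shift (j : ℕ) (a c : ℝ) (k m : ℕ) (h : k + 1 + m ≤ j) :
    Sc j a c k (m + 1) = -(Sc j a c (k + 1) m) * (k + 1) / (m + 1) * qf j a c k
      / (2 * k + m + 1 - (2 * j + 1)) := by
  induction m with
  | zero =>
    have hj : (k : ℝ) + 1 ≤ j := by exact_mod_cast h
    have e1 : (2 * (k : ℝ) - (2 * j + 1)) ≠ 0 := by linarith
    have e2 : (2 * (k : ℝ) + 1 - (2 * j + 1)) ≠ 0 := by linarith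
    simp only [Sc]
    push_cast
    simp only [mul_zero, add_zero]
    generalize (2 * (k : ℝ) - (2 * j + 1)) = W1 at *
    generalize (2 * (k : ℝ) + 1 - (2 * j + 1)) = W2 at *
    field_simp
  | succ m ih =>
    have hj : (k : ℝ) + 1 + (m + 1) ≤ j := by exact_mod_cast h
    have hk : (0 : ℝ) ≤ k := Nat.cast_nonneg k
    have hm : (0 : ℝ) ≤ m := Nat.cast_nonneg m
    rw [Sc, ih (by omega), Sc]
    push_cast
    have e0 : (m : ℝ) + 1 ≠ 0 := by linarith
    have e0' : (m : ℝ) + 1 + 1 ≠ 0 := by linarith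
    have e1 : (2 * (k : ℝ) + m + 1 - (2 * j + 1)) ≠ 0 := by linarith
    have e2 : (2 * (k : ℝ) + (m + 1) + 1 - (2 * j + 1)) ≠ 0 := by linarith
    have e3 : (2 * (k : ℝ) + 2 * (m + 1) - (2 * j + 1)) ≠ 0 := by linarith
    have e4 : (2 * (k : ℝ) + 2 * (m + 1) + 1 - (2 * j + 1)) ≠ 0 := by linarith
    have e5 : (2 * ((k : ℝ) + 1) + 2 * m - (2 * j + 1)) ≠ 0 := by linarith
    have e6 : (2 * ((k : ℝ) + 1) + 2 * m + 1 - (2 * j + 1)) ≠ 0 := by linarith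
    have q1 : qf j a c ((k : ℝ) + (m + 1)) = qf j a c ((k : ℝ) + 1 + m) := by congr 1; ring
    rw [q1]
    generalize qf j a c ((k : ℝ) + 1 + m) = Q1
    generalize qf j a c (k : ℝ) = Q2
    generalize Sc j a c (k + 1) m = s
    rw [show (2 * (k : ℝ) + 2 * (m + 1) - (2 * j + 1)) = 2 * ((k : ℝ) + 1) + 2 * m - (2 * j + 1) by ring,
      show (2 * (k : ℝ) + 2 * (m + 1) + 1 - (2 * j + 1)) = 2 * ((k : ℝ) + 1) + 2 * m + 1 - (2 * j + 1) by ring,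
      show (2 * (k : ℝ) + (m + 1) - (2 * j + 1)) = 2 * (k : ℝ) + m + 1 - (2 * j + 1) by ring,
      show (2 * ((k : ℝ) + 1) + m - (2 * j + 1)) = 2 * (k : ℝ) + (m + 1) + 1 - (2 * j + 1) by ring]
    clear e3 e4 ih hj
    generalize 2 * (k : ℝ) + m + 1 - (2 * j + 1) = W1 at *
    generalize 2 * (k : ℝ) + (m + 1) + 1 - (2 * j + 1) = W2 at *
    generalize 2 * ((k : ℝ) + 1) + 2 * m - (2 * j + 1) = W3 at *
    generalize 2 * ((k : ℝ) + 1) + 2 * m + 1 - (2 * j + 1) = W4 at *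
    field_simp
    ring

/-- the generic `b` -/
def bg (j a c n : ℝ) : ℝ := -(a * (a + j) + c * (c + j) + n * ((2 * j + 1) - n)) / 2
/-- the generic `u` -/
def ug (j a c n : ℝ) : ℝ := n * ((2 * j + 1) + 1 - n) * ((2 * j + 1) - n + a + c) * (n - 1 + a + c)
        * ((n - j - 1) ^ 2 - (a - c) ^ 2) /
      (4 * ((2 * j + 1) - 2 * n) * ((2 * j + 1) - 2 * n + 2))

lemma core (j a c k m s : ℝ) (hj : k + m + 2 ≤ j) (hk : 0 ≤ k) (hm : 0 ≤ m) :
    ∀ s1 s2 s3 : ℝ,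
    s1 = -s * (k + m + 1) / (m + 1) * qf j a c (k + m) * (2 * k + m - (2 * j + 1))
      / ((2 * k + 2 * m - (2 * j + 1)) * (2 * k + 2 * m + 1 - (2 * j + 1))) →
    s2 = -s1 * (k + (m + 1) + 1) / ((m + 1) + 1) * qf j a c (k + (m + 1)) * (2 * k + (m + 1) - (2 * j + 1))
      / ((2 * k + 2 * (m + 1) - (2 * j + 1)) * (2 * k + 2 * (m + 1) + 1 - (2 * j + 1))) →
    s3 = -s1 * k / ((m + 1) + 1) * qf j a c (k - 1) / (2 * k + m - (2 * j + 1)) →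
    s2 = s3 - ((a + k) ^ 2 + bg j a c (k + m + 1)) * s1 - ug j a c (k + m + 1) * s := by
  rintro s1 s2 s3 rfl rfl rfl
  have e0 : m + 1 ≠ 0 := by linarith
  have e0' : m + 1 + 1 ≠ 0 := by linarith
  have e1 : (2 * k + m - (2 * j + 1)) ≠ 0 := by linarith
  have e3 : (2 * k + 2 * m - (2 * j + 1)) ≠ 0 := by linarith
  have e4 : (k + m - j) ≠ 0 := by linarith
  have e5 : (2 * k + 2 * m + 2 - (2 * j + 1)) ≠ 0 := by linarith
  have e6 : (k + m + 1 - j) ≠ 0 := by linarith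
  unfold qf bg ug
  rw [show 2 * k + 2 * m + 1 - (2 * j + 1) = 2 * (k + m - j) by ring,
    show 2 * k + 2 * (m + 1) - (2 * j + 1) = 2 * k + 2 * m + 2 - (2 * j + 1) by ring,
    show 2 * k + 2 * (m + 1) + 1 - (2 * j + 1) = 2 * (k + m + 1 - j) by ring,
    show 2 * j + 1 - 2 * (k + m + 1) + 2 = - (2 * k + 2 * m - (2 * j + 1)) by ring,
    show 2 * j + 1 - 2 * (k + m + 1) = - (2 * k + 2 * m + 2 - (2 * j + 1)) by ring,
    show k + (m + 1) - j = k + m + 1 - j by ring]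
  generalize hw1 : 2 * k + m - (2 * j + 1) = w1 at *
  generalize hw2 : 2 * k + 2 * m - (2 * j + 1) = w2 at *
  generalize hw3 : k + m - j = w3 at *
  generalize hw4 : 2 * k + 2 * m + 2 - (2 * j + 1) = w4 at *
  generalize hw5 : k + m + 1 - j = w5 at *
  generalize hv1 : m + 1 = v1 at *
  generalize hv2 : v1 + 1 = v2 at *
  field_simp
  subst hv2 hv1 hw1 hw2 hw3 hw4 hw5
  ring

lemma core0 (j a c k : ℝ) (hj : k + 1 ≤ j) (hk : 0 ≤ k) :
    -1 * (k + 1) * qf j a c k * (2 * k - (2 * j + 1))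
      / ((2 * k - (2 * j + 1)) * (2 * k + 1 - (2 * j + 1)))
    = -1 * k * qf j a c (k - 1) / (2 * k - 1 - (2 * j + 1)) - ((a + k) ^ 2 + bg j a c k) := by
  have e1 : (2 * k - (2 * j + 1)) ≠ 0 := by linarith
  have e2 : (k - j) ≠ 0 := by linarith
  have e3 : k - 1 - j ≠ 0 := by linarith
  unfold qf bg
  rw [show 2 * k + 1 - (2 * j + 1) = 2 * (k - j) by ring,
    show 2 * k - 1 - (2 * j + 1) = 2 * (k - 1 - j) by ring]
  generalize hw1 : 2 * k - (2 * j + 1) = w1 at *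
  generalize hw2 : k - j = w2 at *
  generalize hw3 : k - 1 - j = w3 at *
  field_simp
  subst hw1 hw2 hw3
  ring

/-- Coefficient of `Φ_k` in `P_n`. -/
def Tc (j a c : ℝ) (n k : ℕ) : ℝ := if k ≤ n then Sc j a c k (n - k) else 0

lemma Tc_add (j a c : ℝ) (k m : ℕ) : Tc j a c (k + m) k = Sc j a c k m := by
  simp [Tc]

lemma Tc_gt (j a c : ℝ) {n k : ℕ} (h : n < k) : Tc j a c n k = 0 := by
  simp [Tc, h]

lemma Tc_succ (j : ℕ) (a c : ℝ) (n k : ℕ) (h : n + 2 ≤ j) :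
    Tc j a c (n + 2) (k + 1) = Tc j a c (n + 1) k
      - ((a + (k + 1)) ^ 2 + bg j a c (n + 1)) * Tc j a c (n + 1) (k + 1)
      - ug j a c (n + 1) * Tc j a c n (k + 1) := by
  have hk : (0 : ℝ) ≤ k := Nat.cast_nonneg k
  rcases lt_trichotomy k n with hkn | rfl | hkn
  · obtain ⟨m, rfl⟩ : ∃ m, n = k + 1 + m := ⟨n - (k + 1), by omega⟩
    have hm : (0 : ℝ) ≤ m := Nat.cast_nonneg m
    have hj : (k : ℝ) + 1 + m + 2 ≤ j := by exact_mod_cast h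
    rw [Tc_add, show k + 1 + m + 1 = k + 1 + (m + 1) by ring, Tc_add,
      show k + 1 + m + 2 = k + 1 + (m + 2) by ring, Tc_add,
      show k + 1 + (m + 1) = k + (m + 2) by ring, Tc_add]
    have := core j a c ((k : ℝ) + 1) m (Sc j a c (k + 1) m) hj (by linarith) hm
      (Sc j a c (k + 1) (m + 1)) (Sc j a c (k + 1) (m + 2)) (Sc j a c k (m + 2))
      (by rw [Sc]; push_cast; rfl) (by rw [Sc]; push_cast; rfl)
      (by
        rw [Sc_shift j a c k (m + 1) (by omega)]
        push_cast
        rw [add_sub_cancel_right]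
        congr 1
        ring)
    rw [this]
    push_cast
    ring_nf
  · rw [Tc_gt _ _ _ (show k < k + 1 by omega), show k + 2 = k + 1 + 1 by ring, Tc_add,
      Tc_add]
    have hj : (k : ℝ) + 2 ≤ j := by exact_mod_cast h
    have e := Tc_add j a c (k + 1) 0
    rw [add_zero] at e
    rw [e, Sc_shift j a c k 0 (by omega)]
    have := core0 j a c (k + 1) (by linarith) (by linarith)
    rw [Sc, Sc, Sc]
    push_cast
    rw [add_sub_cancel_right] at this
    simp only [mul_zero, add_zero, zero_add, div_one, mul_one, sub_zero]
    rw [this]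
    ring
  · rw [Tc_gt _ _ _ (show n < k + 1 by omega), Tc_gt _ _ _ (show n + 1 < k + 1 by omega)]
    rcases (show n + 1 = k ∨ n + 1 < k by omega) with rfl | h'
    · simp [Tc, Sc]
    · rw [Tc_gt _ _ _ (show n + 2 < k + 1 by omega), Tc_gt _ _ _ h']; ring

lemma Tc_zero (j : ℕ) (a c : ℝ) (n : ℕ) (h : n + 2 ≤ j) :
    Tc j a c (n + 2) 0 = 
      - (a ^ 2 + bg j a c (n + 1)) * Tc j a c (n + 1) 0 - ug j a c (n + 1) * Tc j a c n 0 := by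
  have hm : (0 : ℝ) ≤ n := Nat.cast_nonneg n
  have hj : (n : ℝ) + 2 ≤ j := by exact_mod_cast h
  simp only [Tc, zero_le, if_true, Nat.sub_zero]
  have := core j a c 0 n (Sc j a c 0 n) (by linarith) le_rfl hm
      (Sc j a c 0 (n + 1)) (Sc j a c 0 (n + 2)) 0
      (by rw [Sc]; push_cast; rfl) (by rw [Sc]; push_cast; rfl) (by simp)
  rw [this]
  ring_nf

/-- `Φ_k`. -/
def Ph (a y : ℝ) (k : ℕ) : ℝ := ∏ l ∈ Finset.range k, ((a + l) ^ 2 + y)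

/-- The explicit sum. -/
def Fs (j a c y : ℝ) (n : ℕ) : ℝ := ∑ k ∈ Finset.range (n + 1), Tc j a c n k * Ph a y k

lemma Fs_ext (j a c y : ℝ) (n M : ℕ) (h : n + 1 ≤ M) :
    Fs j a c y n = ∑ k ∈ Finset.range M, Tc j a c n k * Ph a y k := by
  unfold Fs
  apply Finset.sum_subset
  · intro x; simp only [Finset.mem_range]; omega
  · intro x _ hx
    rw [Tc_gt _ _ _ (by simp only [Finset.mem_range] at hx; omega), zero_mul]

lemma Fs_rec (j : ℕ) (a c y : ℝ) (n : ℕ) (h : n + 2 ≤ j) :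
    Fs j a c y (n + 2) = (y - bg j a c (n + 1)) * Fs j a c y (n + 1)
      - ug j a c (n + 1) * Fs j a c y n := by
  have hy : y * Fs j a c y (n + 1) = ∑ k ∈ Finset.range (n + 2), Tc j a c (n + 1) k * Ph a y (k + 1)
      - ∑ k ∈ Finset.range (n + 3), (a + k) ^ 2 * Tc j a c (n + 1) k * Ph a y k := by
    rw [Finset.sum_range_succ _ (n + 2), Tc_gt _ _ _ (show n + 1 < n + 2 by omega), mul_zero, zero_mul,
      add_zero, ← Finset.sum_sub_distrib, Fs, Finset.mul_sum]
    apply Finset.sum_congr rfl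
    intro k _
    rw [Ph, Ph, Finset.prod_range_succ]
    ring
  rw [sub_mul, hy, Fs_ext j a c y (n + 1) (n + 3) (by omega), Fs_ext j a c y n (n + 3) (by omega), Fs,
    Finset.sum_range_succ', Finset.sum_range_succ' _ (n + 2), Finset.sum_range_succ' _ (n + 2),
    Finset.sum_range_succ' _ (n + 2), Tc_zero j a c n h]
  have : ∑ k ∈ Finset.range (n + 2), Tc j a c (n + 2) (k + 1) * Ph a y (k + 1) =
      ∑ k ∈ Finset.range (n + 2), Tc j a c (n + 1) k * Ph a y (k + 1)
      - ∑ k ∈ Finset.range (n + 2), (a + (k + 1 : ℕ)) ^ 2 * Tc j a c (n + 1) (k + 1) * Ph a y (k + 1)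
      - bg j a c (n + 1) * ∑ k ∈ Finset.range (n + 2), Tc j a c (n + 1) (k + 1) * Ph a y (k + 1)
      - ug j a c (n + 1) * ∑ k ∈ Finset.range (n + 2), Tc j a c n (k + 1) * Ph a y (k + 1) := by
    rw [Finset.mul_sum, Finset.mul_sum, ← Finset.sum_sub_distrib, ← Finset.sum_sub_distrib,
      ← Finset.sum_sub_distrib]
    apply Finset.sum_congr rfl
    intro k _
    rw [Tc_succ j a c n k h]
    push_cast
    ring
  rw [this]
  push_cast
  ring

lemma bOdd_eq (j : ℕ) (a c α : ℝ) (n : ℕ) (h : n < j) : bOdd j a c α n = bg j a c n := by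
  rw [bOdd, if_neg (by omega), if_neg (by omega), bg]

lemma uOdd_eq (j : ℕ) (a c α : ℝ) (n : ℕ) (h : n < j) : uOdd j a c α n = ug j a c n := by
  rw [uOdd, if_neg (by omega), ug]

lemma P_eq (j : ℕ) (a c α y : ℝ) (n : ℕ) (hn : n ≤ j) :
    (paraRacahOdd j a c α n).eval y = Fs j a c y n := by
  induction n using Nat.strong_induction_on with
  | _ n ih =>
    match n, hn, ih with
    | 0, _, _ => simp [paraRacahOdd, monicOPS, Fs, Tc, Sc, Ph]
    | 1, hn, _ =>
      have hj : (0 : ℝ) + 1 ≤ j := by rw [zero_add]; exact_mod_cast hn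
      have := core0 j a c 0 hj le_rfl
      simp only [paraRacahOdd, monicOPS]
      rw [bOdd_eq _ _ _ _ _ (by omega)]
      simp [Fs, Tc, Ph, Finset.sum_range_succ, Sc] at this ⊢
      rw [this]
      ring
    | n + 2, hn, ih =>
      rw [Fs_rec j a c y n hn, ← ih n (by omega) (by omega), ← ih (n + 1) (by omega) (by omega)]
      have hb := bOdd_eq j a c α (n + 1) (by omega)
      have hu := uOdd_eq j a c α (n + 1) (by omega)
      push_cast at hb hu
      rw [← hb, ← hu]
      simp [paraRacahOdd, monicOPS]

lemma poch_succ (z : ℝ) (k : ℕ) : poch z (k + 1) = poch z k * (z + k) := by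
  rw [poch, poch, Finset.prod_range_succ]

lemma poch_ne (z : ℝ) (k n : ℕ) (hk : k ≤ n) (h : poch z n ≠ 0) : poch z k ≠ 0 := by
  rw [poch, Finset.prod_ne_zero_iff] at h ⊢
  intro i hi
  apply h
  simp only [Finset.mem_range] at hi ⊢
  omega

lemma coef (j : ℕ) (a c : ℝ) (n : ℕ) (hn : n ≤ j)
    (h₁ : poch (a + c) n ≠ 0) (h₂ : poch (a - c - j) n ≠ 0) (m : ℕ) : ∀ k, k + m = n → 
      (poch 1 n * poch (-(j : ℝ)) n * poch (a + c) n * poch (a - c - j) n /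
          (poch (-(n : ℝ)) n * poch ((n : ℝ) - (2 * j + 1)) n)) *
          (poch (-(n : ℝ)) k * poch ((n : ℝ) - (2 * j + 1)) k /
              (poch 1 k * poch (-(j : ℝ)) k * poch (a + c) k * poch (a - c - j) k)) =
      Sc j a c k m := by
  have hnj : (n : ℝ) ≤ j := by exact_mod_cast hn
  have g1 : poch 1 n ≠ 0 := by
    rw [poch, Finset.prod_ne_zero_iff]; intro i _; positivity
  have aux : ∀ i ∈ Finset.range n, (i : ℝ) < n := fun i hi => by
    exact_mod_cast Finset.mem_range.mp hi
  have g2 : poch (-(j : ℝ)) n ≠ 0 := by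
    rw [poch, Finset.prod_ne_zero_iff]; intro i hi; have := aux i hi; linarith
  have g3 : poch (-(n : ℝ)) n ≠ 0 := by
    rw [poch, Finset.prod_ne_zero_iff]; intro i hi; have := aux i hi; linarith
  have g4 : poch ((n : ℝ) - (2 * j + 1)) n ≠ 0 := by
    rw [poch, Finset.prod_ne_zero_iff]; intro i hi; have := aux i hi; linarith
  induction m with
  | zero =>
    rintro k rfl
    simp only [add_zero] at *
    rw [Sc]
    generalize poch ((k : ℝ) - (2 * j + 1)) k = B at *
    field_simp
  | succ m ih =>
    intro k hk
    rw [Sc_shift j a c k m (by omega), ← ih (k + 1) (by omega)]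
    have p1 := poch_ne _ (k + 1) n (by omega) g1
    have p2 := poch_ne _ (k + 1) n (by omega) g2
    have p3 := poch_ne _ (k + 1) n (by omega) h₁
    have p4 := poch_ne _ (k + 1) n (by omega) h₂
    have p5 := poch_ne _ (k + 1) n (by omega) g3
    have p6 := poch_ne _ (k + 1) n (by omega) g4
    generalize poch 1 n * poch (-(j : ℝ)) n * poch (a + c) n * poch (a - c - j) n /
          (poch (-(n : ℝ)) n * poch ((n : ℝ) - (2 * j + 1)) n) = E
    simp only [poch_succ, mul_ne_zero_iff] at p1 p2 p3 p4 p5 p6 ⊢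
    have hkn : (n : ℝ) = k + (m + 1) := by rw [← hk]; push_cast; ring
    obtain ⟨p1, p1'⟩ := p1
    obtain ⟨p2, p2'⟩ := p2
    obtain ⟨p3, p3'⟩ := p3
    obtain ⟨p4, p4'⟩ := p4
    obtain ⟨p5, p5'⟩ := p5
    obtain ⟨p6, p6'⟩ := p6
    have hm : (m : ℝ) + 1 ≠ 0 := by positivity
    rw [show 2 * (k : ℝ) + m + 1 - (2 * j + 1) = (n : ℝ) - (2 * j + 1) + k by rw [hkn]; ring,
      show (-(n : ℝ) + k) = -(m + 1) by rw [hkn]; ring]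
    unfold qf
    rw [show (k : ℝ) - j = -j + k by ring]
    generalize poch (-(n : ℝ)) k = A at *
    generalize poch ((n : ℝ) - (2 * j + 1)) k = B at *
    generalize (n : ℝ) - (2 * j + 1) + k = B' at *
    generalize -(j : ℝ) + k = D at *
    generalize a + c + k = D' at *
    generalize a - c - j + (k : ℝ) = D'' at *
    field_simp
    ring

theorem paraRacahOdd_explicit_low (j : ℕ) (a c α : ℝ) (n : ℕ) (hn : n ≤ j)
    (h₁ : poch (a + c) n ≠ 0) (h₂ : poch (a - c - j) n ≠ 0) :
    ∀ y : ℝ, (paraRacahOdd j a c α n).eval y =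
      (poch 1 n * poch (-(j : ℝ)) n * poch (a + c) n * poch (a - c - j) n /
          (poch (-(n : ℝ)) n * poch ((n : ℝ) - (2 * j + 1)) n)) *
        ∑ k ∈ Finset.range (n + 1),
          poch (-(n : ℝ)) k * poch ((n : ℝ) - (2 * j + 1)) k /
              (poch 1 k * poch (-(j : ℝ)) k * poch (a + c) k * poch (a - c - j) k) *
            ∏ l ∈ Finset.range k, ((a + l) ^ 2 + y) := by
  intro y
  rw [P_eq j a c α y n hn, Fs, Finset.mul_sum]
  apply Finset.sum_congr rfl
  intro k hk
  have hk' : k ≤ n := by simp only [Finset.mem_range] at hk; omega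
  rw [← mul_assoc, coef j a c n hn h₁ h₂ (n - k) k (by omega), Tc, if_pos hk', Ph]
end
end

section
/- The characteristic polynomial of the odd-case para-Racah family factorizes over the quadratic bi-lattice: for all a, c, α ∈ ℝ, P_{N+1}(y) = Π_{s=0}^{j} (y + (a+s)²)(y + (c+s)²) as an identity of polynomials in y. -/
open Filter Topology Polynomial

noncomputable section

/-- Agreement of the recurrence coefficients below `m` gives agreement at `m`. -/
theorem monicOPS_congr (b u b' u' : ℕ → ℝ) (m : ℕ)
    (hb : ∀ n, n < m → b n = b' n) (hu : ∀ n, n < m → n ≠ 0 → u n = u' n) :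
    monicOPS b u m = monicOPS b' u' m := by
  induction m with
  | zero => rfl
  | succ m ih =>
    have h := ih (fun n hn => hb n (by omega)) (fun n hn => hu n (by omega))
    simp only [monicOPS]
    rw [h, hb m (by omega)]
    rcases Nat.eq_zero_or_pos m with h0 | h0
    · subst h0
      simp [monicOPS]
    · rw [hu m (by omega) (by omega)]

/-- Darboux (Christoffel) transformation. -/
theorem monicOPS_darboux (e : ℝ) (p q b u b' u' : ℕ → ℝ) (hq : q 0 = 0)
    (hb : ∀ n, b n = e + p n + q n) (hu : ∀ n, u (n + 1) = p n * q (n + 1))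
    (hb' : ∀ n, b' n = e + p n + q (n + 1)) (hu' : ∀ n, u' n = p n * q n) (n : ℕ) :
    (monicOPS b u n).2 = (monicOPS b' u' n).2 + C (q n) * (monicOPS b' u' n).1 ∧
    (X - C e) * (monicOPS b' u' n).2 =
      (monicOPS b u (n + 1)).2 + C (p n) * (monicOPS b u n).2 := by
  induction n with
  | zero =>
    simp [monicOPS, hb, hq]
    ring
  | succ n ih =>
    obtain ⟨h1, h2⟩ := ih
    have h3 : (monicOPS b u (n + 1)).2 =
        (monicOPS b' u' (n + 1)).2 + C (q (n + 1)) * (monicOPS b' u' (n + 1)).1 := by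
      have : (monicOPS b u (n + 1)).2 = (X - C e) * (monicOPS b' u' n).2
        - C (p n) * (monicOPS b u n).2 := by rw [h2]; ring
      rw [this, h1]
      simp only [monicOPS, hb', hu', map_add, map_mul]
      ring
    refine ⟨h3, ?_⟩
    have h4 : (monicOPS b u (n + 1 + 1)).2 =
        (X - C (b (n + 1))) * (monicOPS b u (n + 1)).2 - C (u (n + 1)) * (monicOPS b u n).2 := rfl
    have h5 : (monicOPS b' u' (n + 1)).2 = (monicOPS b u (n + 1)).2
        - C (q (n + 1)) * (monicOPS b' u' n).2 := by
      rw [h3]; simp only [monicOPS]; ring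
    rw [h4, h5, hb, hu]
    simp only [map_add, map_mul]
    linear_combination (-C (q (n + 1))) * h2

/-- Wilson coefficient `A_n`. -/
def wilA (A B K D x : ℝ) : ℝ :=
  (x + A + B + K + D - 1) * (x + A + B) * (x + A + K) * (x + A + D) /
    ((2 * x + A + B + K + D - 1) * (2 * x + A + B + K + D))

/-- Wilson coefficient `C_n`. -/
def wilC (A B K D x : ℝ) : ℝ :=
  x * (x + B + K - 1) * (x + B + D - 1) * (x + K + D - 1) /
    ((2 * x + A + B + K + D - 2) * (2 * x + A + B + K + D - 1))

/-- Wilson recurrence coefficient `b_n`. -/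
def wilb (A B K D : ℝ) (n : ℕ) : ℝ := -A ^ 2 + wilA A B K D n + wilC A B K D n

/-- Wilson recurrence coefficient `u_n`. -/
def wilu (A B K D : ℝ) (n : ℕ) : ℝ := wilA A B K D (n - 1) * wilC A B K D n

theorem wil_factor (B D : ℝ) (j : ℕ) : ∀ A K : ℝ, A + K = -j → A + B + K + D + 2 * j ≤ 0 →
    (monicOPS (wilb A B K D) (wilu A B K D) (j + 1)).2 =
      ∏ s ∈ Finset.range (j + 1), (X + C ((A + s) ^ 2)) := by
  induction j with
  | zero =>
    intro A K h _
    have hA : wilA A B K D 0 = 0 := by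
      have : (0 : ℝ) + A + K = 0 := by simpa using h
      simp [wilA, this] 
      simp at h
      simp [h]
    simp [monicOPS, wilb, hA, wilC]
  | succ j ih =>
    intro A K h hS
    push_cast at h hS
    have hd := (monicOPS_darboux (-A ^ 2) (fun n => wilA A B K D n) (fun n => wilC A B K D n)
      (wilb A B K D) (wilu A B K D)
      (fun n => -A ^ 2 + wilA A B K D n + wilC A B K D ((n + 1 : ℕ) : ℝ))
      (fun n => wilA A B K D n * wilC A B K D n)
      (by simp [wilC]) (fun n => rfl) (fun n => by simp [wilu]) (fun n => rfl) (fun n => rfl)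
      (j + 1)).2
    have hA : wilA A B K D ((j + 1 : ℕ) : ℝ) = 0 := by
      have : ((j + 1 : ℕ) : ℝ) + A + K = 0 := by push_cast; linarith
      simp only [wilA, this]
      simp
    simp only [hA] at hd
    have hc := monicOPS_congr
      (fun n => -A ^ 2 + wilA A B K D n + wilC A B K D ((n + 1 : ℕ) : ℝ))
      (fun n => wilA A B K D n * wilC A B K D n)
      (wilb (A + 1) B K D) (wilu (A + 1) B K D) (j + 1) (by
        intro n hn
        have hn' : (n : ℝ) ≤ j := by exact_mod_cast Nat.lt_succ_iff.mp hn
        have e1 : 2 * (n : ℝ) + A + B + K + D - 1 ≠ 0 := by intro; linarith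
        have e2 : 2 * (n : ℝ) + A + B + K + D ≠ 0 := by intro; linarith
        have e3 : 2 * (n : ℝ) + A + B + K + D + 1 ≠ 0 := by intro; linarith
        simp only [wilb, wilA, wilC]
        push_cast
        rw [show 2 * ((n : ℝ) + 1) + A + B + K + D - 2 = 2 * (n : ℝ) + A + B + K + D by ring,
          show 2 * ((n : ℝ) + 1) + A + B + K + D - 1 = 2 * (n : ℝ) + A + B + K + D + 1 by ring,
          show 2 * (n : ℝ) + (A + 1) + B + K + D - 2 = 2 * (n : ℝ) + A + B + K + D - 1 by ring,
          show 2 * (n : ℝ) + (A + 1) + B + K + D - 1 = 2 * (n : ℝ) + A + B + K + D by ring,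
          show 2 * (n : ℝ) + (A + 1) + B + K + D = 2 * (n : ℝ) + A + B + K + D + 1 by ring]
        obtain ⟨T, hT⟩ : ∃ T, T = 2 * (n : ℝ) + A + B + K + D := ⟨_, rfl⟩
        rw [← hT] at e1 e2 e3 ⊢
        obtain rfl : D = T - 2 * n - A - B - K := by linarith
        clear hT hS hA hd h hn hn' ih
        generalize (n : ℝ) = x
        field_simp
        ring)
      (by
        intro n hn _
        have hn' : (n : ℝ) ≤ j := by exact_mod_cast Nat.lt_succ_iff.mp hn
        have e1 : 2 * (n : ℝ) + A + B + K + D - 1 ≠ 0 := by intro; linarith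
        have e2 : 2 * (n : ℝ) + A + B + K + D ≠ 0 := by intro; linarith
        have e3 : 2 * (n : ℝ) + A + B + K + D - 2 ≠ 0 := by intro; linarith
        simp only [wilu, wilA, wilC]
        rw [show 2 * ((n : ℝ) - 1) + (A + 1) + B + K + D - 1
              = 2 * (n : ℝ) + A + B + K + D - 2 by ring,
          show 2 * ((n : ℝ) - 1) + (A + 1) + B + K + D = 2 * (n : ℝ) + A + B + K + D - 1 by ring,
          show 2 * (n : ℝ) + (A + 1) + B + K + D - 2 = 2 * (n : ℝ) + A + B + K + D - 1 by ring,
          show 2 * (n : ℝ) + (A + 1) + B + K + D - 1 = 2 * (n : ℝ) + A + B + K + D by ring]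
        field_simp
        ring)
    rw [hc, ih (A + 1) K (by linarith) (by linarith)] at hd
    rw [Finset.prod_range_succ']
    simp only [map_zero, zero_mul, add_zero] at hd
    rw [← hd, mul_comm]
    congr 1
    · refine Finset.prod_congr rfl fun s _ => ?_
      push_cast
      congr 3
      ring
    · simp

/-- Gluing a tridiagonal recurrence at an intermediate index. -/
theorem monicOPS_glue (b u : ℕ → ℝ) (M m : ℕ) (hm : m ≤ M) :
    (monicOPS b u (M + 1)).2 =
      (monicOPS b u (M + 1 - m)).2 *
        (monicOPS (fun n => b (M - n)) (fun n => u (M + 1 - n)) m).2 -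
      C (u (M + 1 - m)) * (monicOPS b u (M + 1 - m)).1 *
        (monicOPS (fun n => b (M - n)) (fun n => u (M + 1 - n)) m).1 := by
  induction m with
  | zero => simp [monicOPS]
  | succ m ih =>
    rw [ih (by omega)]
    obtain ⟨k, hk⟩ : ∃ k, M = k + 1 + m := ⟨M - m - 1, by omega⟩
    subst hk
    have h1 : k + 1 + m + 1 - m = k + 1 + 1 := by omega
    have h2 : k + 1 + m + 1 - (m + 1) = k + 1 := by omega
    have h3 : k + 1 + m - m = k + 1 := by omega
    rw [h1, h2]
    simp only [monicOPS, h1, h3]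
    ring

theorem bOdd_reflect (j : ℕ) (a c α : ℝ) (n : ℕ) (hn : n ≤ j) :
    bOdd j a c α (2 * j + 1 - n) = bOdd j a c (1 - α) n := by
  rcases eq_or_lt_of_le hn with h | h
  · subst h
    have : 2 * n + 1 - n = n + 1 := by omega
    simp [bOdd, this]
  · have h1 : 2 * j + 1 - n ≠ j := by omega
    have h2 : 2 * j + 1 - n ≠ j + 1 := by omega
    have h3 : n ≠ j := by omega
    have h4 : n ≠ j + 1 := by omega
    simp only [bOdd, h1, h2, h3, h4, if_false]
    rw [Nat.cast_sub (by omega)]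
    push_cast
    ring

theorem uOdd_reflect (j : ℕ) (a c α : ℝ) (n : ℕ) (hn : n ≤ j) :
    uOdd j a c α (2 * j + 1 + 1 - n) = uOdd j a c (1 - α) n := by
  have h2 : 2 * j + 1 + 1 - n ≠ j + 1 := by omega
  have h4 : n ≠ j + 1 := by omega
  simp only [uOdd, h2, h4, if_false]
  rw [Nat.cast_sub (by omega)]
  push_cast
  congr 1 <;> ring

theorem paraRacahOdd_zero (j : ℕ) (a c : ℝ) :
    paraRacahOdd j a c 0 (j + 1) = ∏ s ∈ Finset.range (j + 1), (X + C ((a + s) ^ 2)) := by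
  rw [← wil_factor c (-j - c) j a (-j - a) (by ring) (by linarith), paraRacahOdd]
  congr 1
  apply monicOPS_congr
  · intro n hn
    rcases eq_or_lt_of_le (Nat.lt_succ_iff.mp hn) with h | h
    · subst h
      simp only [bOdd, wilb, wilA, wilC, if_true]
      rw [show (n : ℝ) + a + (-n - a) = 0 by ring,
        show 2 * (n : ℝ) + a + c + (-n - a) + (-n - c) - 2 = -2 by ring,
        show 2 * (n : ℝ) + a + c + (-n - a) + (-n - c) - 1 = -1 by ring]
      simp
      ring
    · have h3 : n ≠ j := by omega
      have h4 : n ≠ j + 1 := by omega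
      have hn' : (n : ℝ) + 1 ≤ j := by exact_mod_cast h
      simp only [bOdd, wilb, wilA, wilC, h3, h4, if_false]
      have e1 : 2 * (n : ℝ) - 2 * j - 1 ≠ 0 := by intro; linarith
      have e2 : (n : ℝ) - j ≠ 0 := by intro; linarith
      have e3 : (n : ℝ) - j - 1 ≠ 0 := by intro; linarith
      rw [show 2 * (n : ℝ) + a + c + (-j - a) + (-j - c) - 2 = 2 * ((n : ℝ) - j - 1) by ring,
        show 2 * (n : ℝ) + a + c + (-j - a) + (-j - c) - 1 = 2 * (n : ℝ) - 2 * j - 1 by ring,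
        show 2 * (n : ℝ) + a + c + (-j - a) + (-j - c) = 2 * ((n : ℝ) - j) by ring]
      obtain ⟨m, hm⟩ : ∃ m, m = (n : ℝ) - j := ⟨_, rfl⟩
      rw [show 2 * (n : ℝ) - 2 * j - 1 = 2 * m - 1 by rw [hm]; ring] at e1 ⊢
      rw [← hm] at e2 e3 ⊢
      rw [show (n : ℝ) = m + j by linarith]
      clear hn' hm
      generalize (j : ℝ) = x
      obtain ⟨t, rfl⟩ : ∃ t, m = t / 2 := ⟨2 * m, by ring⟩
      have f1 : t - 1 ≠ 0 := fun h => e1 (by linarith)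
      have f2 : t ≠ 0 := fun h => e2 (by linarith)
      have f3 : t - 2 ≠ 0 := fun h => e3 (by linarith)
      rw [show 2 * (t / 2) - 1 = t - 1 by ring, show 2 * (t / 2 - 1) = t - 2 by ring,
        show 2 * (t / 2) = t by ring]
      field_simp
      ring
  · intro n hn _
    have h4 : n ≠ j + 1 := by omega
    have hn' : (n : ℝ) ≤ j := by exact_mod_cast Nat.lt_succ_iff.mp hn
    simp only [uOdd, wilu, wilA, wilC, h4, if_false]
    have e1 : 2 * (n : ℝ) - 2 * j - 1 ≠ 0 := by intro; linarith
    have e2 : 2 * (n : ℝ) - 2 * j - 3 ≠ 0 := by intro; linarith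
    have e3 : (n : ℝ) - j - 1 ≠ 0 := by intro; linarith
    rw [show 2 * (n : ℝ) + a + c + (-j - a) + (-j - c) - 2 = 2 * ((n : ℝ) - j - 1) by ring,
      show 2 * (n : ℝ) + a + c + (-j - a) + (-j - c) - 1 = 2 * (n : ℝ) - 2 * j - 1 by ring,
      show 2 * ((n : ℝ) - 1) + a + c + (-j - a) + (-j - c) - 1 = 2 * (n : ℝ) - 2 * j - 3 by ring,
      show 2 * ((n : ℝ) - 1) + a + c + (-j - a) + (-j - c) = 2 * ((n : ℝ) - j - 1) by ring,
      show 2 * (j : ℝ) + 1 - 2 * n + 2 = -(2 * (n : ℝ) - 2 * j - 3) by ring,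
      show 2 * (j : ℝ) + 1 - 2 * n = -(2 * (n : ℝ) - 2 * j - 1) by ring]
    field_simp
    ring

theorem paraRacahOdd_swap (j : ℕ) (a c : ℝ) :
    paraRacahOdd j a c 1 (j + 1) = paraRacahOdd j c a 0 (j + 1) := by
  rw [paraRacahOdd, paraRacahOdd]
  congr 1
  apply monicOPS_congr
  · intro n hn
    have h4 : n ≠ j + 1 := by omega
    simp only [bOdd, h4, if_false]
    split_ifs <;> ring
  · intro n hn _
    have h4 : n ≠ j + 1 := by omega
    simp only [uOdd, h4, if_false]
    ring

theorem paraRacahOdd_alpha (j : ℕ) (a c α : ℝ) :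
    monicOPS (bOdd j a c α) (uOdd j a c α) j = monicOPS (bOdd j a c 0) (uOdd j a c 0) j := by
  apply monicOPS_congr
  · intro n hn
    have h3 : n ≠ j := by omega
    have h4 : n ≠ j + 1 := by omega
    simp only [bOdd, h3, h4, if_false]
  · intro n hn _
    have h4 : n ≠ j + 1 := by omega
    simp only [uOdd, h4, if_false]

theorem paraRacahOdd_succ (j : ℕ) (a c α : ℝ) :
    paraRacahOdd j a c α (j + 1) = paraRacahOdd j a c 0 (j + 1) -
      C (α * ((a - c) * (1 + (j : ℝ)) * (a + c + j))) * paraRacahOdd j a c 0 j := by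
  have h4 : j ≠ j + 1 := by omega
  have hb : bOdd j a c α j = bOdd j a c 0 j + α * ((a - c) * (1 + (j : ℝ)) * (a + c + j)) := by
    simp only [bOdd, if_true]; ring
  have hu : uOdd j a c α j = uOdd j a c 0 j := by
    simp only [uOdd, h4, if_false]
  simp only [paraRacahOdd, monicOPS]
  rw [paraRacahOdd_alpha j a c α, hb, hu, map_add]
  ring

theorem paraRacahOdd_characteristic_poly (j : ℕ) (a c α : ℝ) :
    paraRacahOdd j a c α (2 * j + 2) =
      ∏ s ∈ Finset.range (j + 1), ((X + C ((a + s) ^ 2)) * (X + C ((c + s) ^ 2))) := by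
  have hg := monicOPS_glue (bOdd j a c α) (uOdd j a c α) (2 * j + 1) (j + 1) (by omega)
  rw [monicOPS_congr (fun n => bOdd j a c α (2 * j + 1 - n))
    (fun n => uOdd j a c α (2 * j + 1 + 1 - n)) (bOdd j a c (1 - α)) (uOdd j a c (1 - α)) (j + 1)
    (fun n hn => bOdd_reflect j a c α n (by omega))
    (fun n hn _ => uOdd_reflect j a c α n (by omega)),
    show 2 * j + 1 + 1 - (j + 1) = j + 1 by omega] at hg
  have e1 : ∀ β, (monicOPS (bOdd j a c β) (uOdd j a c β) (j + 1)).1 = paraRacahOdd j a c 0 j := by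
    intro β
    simp only [monicOPS, paraRacahOdd]
    rw [paraRacahOdd_alpha j a c β]
  have e2 : ∀ β, (monicOPS (bOdd j a c β) (uOdd j a c β) (j + 1)).2
      = paraRacahOdd j a c β (j + 1) := fun β => rfl
  have hu : uOdd j a c α (j + 1) = α * (1 - α) * ((a - c) * (1 + (j : ℝ)) * (a + c + j)) ^ 2 := by
    simp only [uOdd, if_true]; ring
  have h1 := paraRacahOdd_succ j a c 1
  rw [paraRacahOdd_swap, paraRacahOdd_zero j c a, one_mul] at h1
  rw [e1, e1, e2, e2, paraRacahOdd_succ j a c α, paraRacahOdd_succ j a c (1 - α), hu] at hg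
  rw [Finset.prod_mul_distrib, h1, ← paraRacahOdd_zero j a c]
  refine hg.trans ?_
  simp only [map_mul, map_pow, map_sub, map_one]
  ring
end
end

section
/- The characteristic polynomial of the even-case para-Racah family factorizes over the quadratic bi-lattice: for all a, c, α ∈ ℝ, P_{N+1}(y) = Π_{s=0}^{j} (y + (a+s)²) · Π_{s=0}^{j-1} (y + (c+s)²) as an identity of polynomials in y. -/
open Filter Topology Polynomial

noncomputable section

/-- The recurrence coefficient `bₙ` of the para-Racah polynomials, even case `N = 2j`. -/
def bEven (j : ℕ) (a c : ℝ) (n : ℕ) : ℝ :=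
  ((n : ℝ) - 2 * j) * ((n : ℝ) + a + c) * ((n : ℝ) + a - c - j + 1) /
      (2 * (2 * (n : ℝ) + 1 - 2 * j)) +
    (n : ℝ) * ((n : ℝ) - 2 * j - a - c) * ((n : ℝ) - j - 1 + c - a) /
      (2 * (2 * (n : ℝ) - 1 - 2 * j)) - a ^ 2

/-- The recurrence coefficient `uₙ` of the para-Racah polynomials, even case `N = 2j`. -/
def uEven (j : ℕ) (a c α : ℝ) (n : ℕ) : ℝ :=
  if n = j then
    -(1 - α) * (j : ℝ) * ((j : ℝ) + 1) * (a - c) * (a - c + 1) * (a + c + j - 1) * (a + c + j) / 2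
  else if n = j + 1 then
    -α * (j : ℝ) * ((j : ℝ) + 1) * (a - c) * (a - c + 1) * (a + c + j - 1) * (a + c + j) / 2
  else
    (n : ℝ) * (2 * (j : ℝ) - n + 1) * (a + c + n - 1) * (a - c + j - n + 1)
        * (-a + c + j - n) * (a + c + 2 * j - n) /
      (4 * (2 * (j : ℝ) - 2 * n + 1) ^ 2)

/-- The monic para-Racah polynomial `Pₙ`, even case `N = 2j`. -/
def paraRacahEven (j : ℕ) (a c α : ℝ) (n : ℕ) : Polynomial ℝ :=
  (monicOPS (bEven j a c) (uEven j a c α) n).2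

/-- Coefficients of the expansion in the shifted basis. -/
def pcoef (N : ℝ) (f : ℝ → ℝ) (n k : ℕ) : ℝ :=
  (n.choose k : ℝ) * ∏ i ∈ Finset.Ico k n, f i / (N - n - i)

/-- The quadratic-lattice basis. -/
def qbasis (e : ℝ) (k : ℕ) : Polynomial ℝ := ∏ s ∈ Finset.range k, (X + C ((e + s) ^ 2))

/-- The expansion. -/
def expan (e : ℝ) (p : ℕ → ℝ) (n : ℕ) : Polynomial ℝ :=
  ∑ k ∈ Finset.range (n + 1), C (p k) * qbasis e k

lemma X_mul_qbasis (e : ℝ) (k : ℕ) :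
    X * qbasis e k = qbasis e (k + 1) - C ((e + k) ^ 2) * qbasis e k := by
  simp only [qbasis, Finset.prod_range_succ]; ring

lemma expan_step (e b u : ℝ) (p q r : ℕ → ℝ) (n : ℕ)
    (hp : p (n + 1) = 0)
    (h0 : q 0 = -((e + (0 : ℕ)) ^ 2 + b) * p 0 - u * r 0)
    (hs : ∀ k ≤ n, q (k + 1) = p k - ((e + (k + 1 : ℕ)) ^ 2 + b) * p (k + 1) - u * r (k + 1)) :
    expan e q (n + 1) = (X - C b) * expan e p n - C u * expan e r (n + 1) := by
  have hpe : expan e p n = expan e p (n + 1) := by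
    simp only [expan]
    rw [Finset.sum_range_succ _ (n + 1), hp]; simp
  have hX : X * expan e p n = ∑ k ∈ Finset.range (n + 1), C (p k) * qbasis e (k + 1)
      - ∑ k ∈ Finset.range (n + 2), C ((e + k) ^ 2 * p k) * qbasis e k := by
    rw [Finset.sum_range_succ _ (n + 1), hp]
    simp only [expan, Finset.mul_sum, mul_zero, C_0, zero_mul, add_zero]
    rw [← Finset.sum_sub_distrib]
    refine Finset.sum_congr rfl fun k _ => ?_
    rw [mul_left_comm, X_mul_qbasis, C_mul]; ring
  rw [sub_mul, hX, hpe]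
  simp only [expan]
  rw [Finset.sum_range_succ' _ (n + 1), Finset.sum_range_succ' _ (n + 1),
    Finset.sum_range_succ' _ (n + 1), Finset.sum_range_succ' _ (n + 1), h0]
  rw [Finset.sum_congr rfl (fun k hk => by
    rw [hs k (by have := Finset.mem_range.1 hk; omega)])]
  simp only [C_add, C_sub, C_mul, C_neg, sub_mul, Finset.sum_sub_distrib, add_mul,
    Finset.sum_add_distrib, mul_add, Finset.mul_sum, neg_mul]
  simp only [mul_assoc]
  ring

lemma pcoef_self (N : ℝ) (f : ℝ → ℝ) (n : ℕ) : pcoef N f n n = 1 := by simp [pcoef]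

lemma pcoef_gt (N : ℝ) (f : ℝ → ℝ) (n k : ℕ) (h : n < k) : pcoef N f n k = 0 := by
  simp [pcoef, Nat.choose_eq_zero_of_lt h]

lemma pcoef_L1 (N : ℝ) (f : ℝ → ℝ) (n k : ℕ) (h : k < n) (hN : N - n - k ≠ 0) :
    ((n : ℝ) - k) * (N - n - k) * pcoef N f n k = (k + 1) * f k * pcoef N f n (k + 1) := by
  have h1 := Nat.choose_succ_right_eq n k
  have h2 : (n.choose (k + 1) : ℝ) * (k + 1) = n.choose k * ((n : ℝ) - k) := by
    rw [← Nat.cast_sub h.le]; exact_mod_cast h1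
  rw [pcoef, pcoef, Finset.prod_eq_prod_Ico_succ_bot h]
  generalize (∏ i ∈ Finset.Ico (k + 1) n, f i / (N - n - i)) = Z
  field_simp
  linear_combination (-f k * Z) * h2

lemma pcoef_L2 (N : ℝ) (f : ℝ → ℝ) (m : ℕ) : ∀ k n : ℕ, k + m = n → (2 * n + 1 < N) →
    ((n : ℝ) + 1 - k) * (N - 2 * n) * (N - 2 * n - 1) * pcoef N f (n + 1) k
      = (n + 1) * f n * (N - n - k) * pcoef N f n k := by
  induction m with
  | zero =>
    rintro k n rfl hN
    simp only [add_zero] at *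
    have hz : N - 2 * k - 1 ≠ 0 := by intro h; linarith
    have h1 := pcoef_L1 N f (k + 1) k (by omega) (by push_cast; intro h; apply hz; linarith)
    rw [pcoef_self] at h1 ⊢
    push_cast at h1
    linear_combination (N - 2 * k) * h1
  | succ m ih =>
    rintro k n hk hN
    have hk' : (k : ℝ) + m + 1 = n := by exact_mod_cast (by omega : k + m + 1 = n)
    have hm : (0 : ℝ) ≤ m := Nat.cast_nonneg m
    have ih' := ih (k + 1) n (by omega) hN
    have z1 : N - n - k ≠ 0 := by intro h; linarith
    have z2 : N - n - 1 - k ≠ 0 := by intro h; linarith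
    have z3 : (n : ℝ) - k ≠ 0 := by intro h; linarith
    have h1 := pcoef_L1 N f (n + 1) k (by omega) (by push_cast; intro h; apply z2; linarith)
    have h2 := pcoef_L1 N f n k (by omega) z1
    push_cast at *
    apply mul_left_cancel₀ (mul_ne_zero z2 z3)
    linear_combination ((N - 2 * n) * (N - 2 * n - 1) * (n - k)) * h1 + (k + 1) * f k * ih'
      - ((n + 1) * f n * (N - n - 1 - k)) * h2

/-- Generic coefficient statement. -/
lemma pcoef_rel (N e b u : ℝ) (f : ℝ → ℝ) (q r : ℕ → ℝ) (n : ℕ) (hN : 2 * n ≤ N)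
    (hq : q (n + 1) = 1) (hr : r (n + 1) = 0)
    (H : ∀ k ≤ n, ∀ T : ℝ,
      ((n : ℝ) - k + 1) * (N - n - k + 1) * T = k * f (k - 1) * pcoef N f n k →
      q k = T - ((e + k) ^ 2 + b) * pcoef N f n k - u * r k) :
    expan e q (n + 1) = (X - C b) * expan e (pcoef N f n) n - C u * expan e r (n + 1) := by
  apply expan_step
  · exact pcoef_gt _ _ _ _ (by omega)
  · rw [H 0 (by omega) 0 (by simp)]; ring
  · intro k hk
    rcases hk.eq_or_lt with rfl | hk
    · rw [hq, hr, pcoef_self, pcoef_gt _ _ _ _ (by omega)]; ring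
    · apply H (k + 1) (by omega)
      have hk' : (k : ℝ) + 1 ≤ n := by exact_mod_cast hk
      have := pcoef_L1 N f n k hk (by intro h; linarith)
      push_cast
      rw [add_sub_cancel_right]
      linear_combination this

lemma mirror (b u : ℕ → ℝ) (j : ℕ) (hb : ∀ m < j, b (2 * j - m) = b m)
    (hu : ∀ m < j, u (2 * j + 1 - m) = u m) :
    ∀ m ≤ j, ∀ n, n + m = 2 * j + 1 →
      (monicOPS b u (2 * j + 1)).2 = (monicOPS b u n).2 * (monicOPS b u m).2
      - C (u n) * (monicOPS b u n).1 * (monicOPS b u m).1 := by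
  intro m
  induction m with
  | zero => intro _ n hn; obtain rfl : n = 2 * j + 1 := by omega
            simp [monicOPS]
  | succ m ih =>
    intro hm n hn
    rw [ih (by omega) (n + 1) (by omega)]
    have h1 := hb m (by omega)
    have h2 := hu m (by omega)
    rw [show 2 * j - m = n by omega] at h1
    rw [show 2 * j + 1 - m = n + 1 by omega] at h2
    simp only [monicOPS, h1, h2]
    ring

lemma bEven_mirror (j : ℕ) (a c : ℝ) (m : ℕ) (hm : m < j) :
    bEven j a c (2 * j - m) = bEven j a c m := by
  have hm' : (m : ℝ) + 1 ≤ j := by exact_mod_cast hm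
  simp only [bEven]
  rw [Nat.cast_sub (by omega)]
  push_cast
  have z1 : (2 * (m : ℝ) + 1 - 2 * j) ≠ 0 := by intro h; linarith
  have z2 : (2 * (m : ℝ) - 1 - 2 * j) ≠ 0 := by intro h; linarith
  have z3 : 2 * (2 * (j : ℝ) - m) + 1 - 2 * j ≠ 0 := by intro h; linarith
  have z4 : 2 * (2 * (j : ℝ) - m) - 1 - 2 * j ≠ 0 := by intro h; linarith
  field_simp
  ring

lemma uEven_generic (j : ℕ) (a c α : ℝ) (m : ℕ) (hm : m < j) :
    uEven j a c α m = (m : ℝ) * (2 * (j : ℝ) - m + 1) * (a + c + m - 1) * (a - c + j - m + 1)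
        * (-a + c + j - m) * (a + c + 2 * j - m) / (4 * (2 * (j : ℝ) - 2 * m + 1) ^ 2) := by
  rw [uEven, if_neg (by omega), if_neg (by omega)]

lemma uEven_mirror (j : ℕ) (a c α : ℝ) (m : ℕ) (hm : m < j) :
    uEven j a c α (2 * j + 1 - m) = uEven j a c α m := by
  have hm' : (m : ℝ) + 1 ≤ j := by exact_mod_cast hm
  rw [uEven_generic _ _ _ _ _ hm, uEven, if_neg (by omega), if_neg (by omega)]
  rw [Nat.cast_sub (by omega)]
  push_cast
  have z1 : (2 * (j : ℝ) - 2 * m + 1) ≠ 0 := by intro h; linarith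
  have z2 : 2 * (j : ℝ) - 2 * (2 * j + 1 - m) + 1 ≠ 0 := by intro h; linarith
  field_simp
  ring

/-- Structure function in the basis at `a`. -/
def fA (j : ℕ) (a c : ℝ) (x : ℝ) : ℝ := (x - j) * (a + c + x) * (a - c + 1 - j + x)

/-- Structure function in the basis at `c`. -/
def fC (j : ℕ) (a c : ℝ) (x : ℝ) : ℝ := (c + a + x) * (c - a - j + x) * (x + 1 - j)

/-- The generic off-diagonal coefficient. -/
def ugen (j : ℕ) (a c : ℝ) (m : ℝ) : ℝ :=
  (m : ℝ) * (2 * (j : ℝ) - m + 1) * (a + c + m - 1) * (a - c + j - m + 1)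
        * (-a + c + j - m) * (a + c + 2 * j - m) / (4 * (2 * (j : ℝ) - 2 * m + 1) ^ 2)

lemma vA (j : ℕ) (a c : ℝ) (n k : ℕ) (hk : k ≤ n) (hn : n ≤ j) :
    (2 * (j : ℝ) - n + 1 - k) * (ugen j a c n * pcoef (2 * j) (fA j a c) (n - 1) k)
    = (n - k) * (2 * j - n + 1) * (a - c + j - n + 1) * (a + c + 2 * j - n)
      / (2 * (2 * j - 2 * n + 1)) * pcoef (2 * j) (fA j a c) n k := by
  rcases n with _ | n
  · obtain rfl : k = 0 := by omega
    simp [ugen]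
  rcases hk.eq_or_lt with rfl | hk
  · rw [pcoef_gt _ _ _ _ (by omega)]; simp
  have hn' : (n : ℝ) + 1 ≤ j := by exact_mod_cast hn
  have h := pcoef_L2 (2 * j) (fA j a c) (n - k) k n (by omega) (by linarith)
  have z1 : (2 * (j : ℝ) - 2 * n - 1) ≠ 0 := by intro h; linarith
  have z2 : (2 * (j : ℝ) - 2 * n) ≠ 0 := by intro h; linarith
  have z3 : (2 * (j : ℝ) - 2 * (n + 1) + 1) ≠ 0 := by intro h; linarith
  have z9 : 2 * ((j : ℝ) - (n + 1)) + 1 ≠ 0 := by intro h; linarith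
  have z4 : (j : ℝ) - n ≠ 0 := by intro h; linarith
  rw [add_tsub_cancel_right]
  generalize pcoef _ _ (n + 1) k = p at *
  generalize pcoef _ _ n k = r at *
  simp only [ugen, fA] at h ⊢
  push_cast
  field_simp
  apply mul_left_cancel₀ z4
  linear_combination (-2 * (2 * (j : ℝ) - n) * (a - c + j - n) * (a + c + 2 * j - n - 1)) * h

lemma vC (j : ℕ) (a c : ℝ) (n k : ℕ) (hk : k ≤ n) (hn : n < j) :
    (2 * (j : ℝ) - n + 1 - k) * (ugen j a c n * pcoef (2 * j) (fC j a c) (n - 1) k)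
    = (n - k) * (2 * j - n + 1) * (c - a + j - n) * (a + c + 2 * j - n) * (j + 1 - n)
      / (2 * (2 * j - 2 * n + 1) * (j - n)) * pcoef (2 * j) (fC j a c) n k := by
  rcases n with _ | n
  · obtain rfl : k = 0 := by omega
    simp [ugen]
  rcases hk.eq_or_lt with rfl | hk
  · rw [pcoef_gt _ _ _ _ (by omega)]; simp
  have hn' : (n : ℝ) + 1 + 1 ≤ j := by exact_mod_cast hn
  have h := pcoef_L2 (2 * j) (fC j a c) (n - k) k n (by omega) (by linarith)
  have z1 : (2 * (j : ℝ) - 2 * n - 1) ≠ 0 := by intro h; linarith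
  have z3 : (2 * (j : ℝ) - 2 * (n + 1) + 1) ≠ 0 := by intro h; linarith
  have z9 : 2 * ((j : ℝ) - (n + 1)) + 1 ≠ 0 := by intro h; linarith
  have z4 : (j : ℝ) - (n + 1) ≠ 0 := by intro h; linarith
  rw [add_tsub_cancel_right]
  generalize pcoef _ _ (n + 1) k = p at *
  generalize pcoef _ _ n k = r at *
  simp only [ugen, fC] at h ⊢
  push_cast
  field_simp
  linear_combination (-2 * (2 * (j : ℝ) - n) * (c - a + j - n - 1) * (a + c + 2 * j - n - 1)) * h

lemma relA (j : ℕ) (a c : ℝ) (n k : ℕ) (hk : k ≤ n) (hn : n < j) (T : ℝ)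
    (hT : ((n : ℝ) - k + 1) * (2 * j - n - k + 1) * T
      = k * fA j a c (k - 1) * pcoef (2 * j) (fA j a c) n k) :
    pcoef (2 * j) (fA j a c) (n + 1) k = T - ((a + k) ^ 2 + bEven j a c n)
      * pcoef (2 * j) (fA j a c) n k - ugen j a c n * pcoef (2 * j) (fA j a c) (n - 1) k := by
  have hn' : (n : ℝ) + 1 ≤ j := by exact_mod_cast hn
  have hk' : (k : ℝ) ≤ n := by exact_mod_cast hk
  have hv := vA j a c n k hk hn.le
  have h := pcoef_L2 (2 * j) (fA j a c) (n - k) k n (by omega) (by linarith)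
  generalize ugen j a c n * pcoef (2 * j) (fA j a c) (n - 1) k = v at *
  have z1 : (2 * (j : ℝ) - 2 * n - 1) ≠ 0 := by intro h; linarith
  have z2 : (2 * (j : ℝ) - 2 * n) ≠ 0 := by intro h; linarith
  have z3 : (n : ℝ) + 1 - k ≠ 0 := by intro h; linarith
  have z4 : (j : ℝ) - n ≠ 0 := by intro h; linarith
  have z5 : 2 * (j : ℝ) - n + 1 - k ≠ 0 := by intro h; linarith
  have z9 : (j : ℝ) * 2 - n + 1 - k ≠ 0 := by intro h; linarith
  have z6 : (2 * (j : ℝ) - 2 * n + 1) ≠ 0 := by intro h; linarith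
  have z7 : (2 * (n : ℝ) + 1 - 2 * j) ≠ 0 := by intro h; linarith
  have z8 : (2 * (n : ℝ) - 1 - 2 * j) ≠ 0 := by intro h; linarith
  generalize pcoef _ _ (n + 1) k = q at *
  generalize pcoef _ _ n k = p at *
  simp only [fA, bEven] at h hT ⊢
  have hq : q = (n + 1) * ((n - j) * (a + c + n) * (a - c + 1 - j + n)) * (2 * j - n - k) * p
      / ((n + 1 - k) * (2 * j - 2 * n) * (2 * j - 2 * n - 1)) := by
    rw [eq_div_iff (by positivity)]; linear_combination h
  have hT' : T = k * ((k - 1 - j) * (a + c + (k - 1)) * (a - c + 1 - j + (k - 1))) * p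
      / ((n + 1 - k) * (2 * j - n + 1 - k)) := by
    rw [eq_div_iff (by positivity)]; linear_combination hT
  have hv' : v = (n - k) * (2 * j - n + 1) * (a - c + j - n + 1) * (a + c + 2 * j - n) * p
      / (2 * (2 * j - 2 * n + 1) * (2 * j - n + 1 - k)) := by
    field_simp; field_simp at hv; linear_combination hv
  rw [hq, hT', hv', show 2 * (n : ℝ) + 1 - 2 * j = -(2 * (j : ℝ) - 2 * n - 1) by ring,
    show 2 * (n : ℝ) - 1 - 2 * j = -(2 * (j : ℝ) - 2 * n + 1) by ring,
    show 2 * (j : ℝ) - 2 * n = 2 * (j - n) by ring] at *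
  field_simp
  ring

lemma relC (j : ℕ) (a c : ℝ) (n k : ℕ) (hk : k ≤ n) (hn : n < j) (T : ℝ)
    (hT : ((n : ℝ) - k + 1) * (2 * j - n - k + 1) * T
      = k * fC j a c (k - 1) * pcoef (2 * j) (fC j a c) n k) :
    pcoef (2 * j) (fC j a c) (n + 1) k = T - ((c + k) ^ 2 + bEven j a c n)
      * pcoef (2 * j) (fC j a c) n k - ugen j a c n * pcoef (2 * j) (fC j a c) (n - 1) k := by
  have hn' : (n : ℝ) + 1 ≤ j := by exact_mod_cast hn
  have hk' : (k : ℝ) ≤ n := by exact_mod_cast hk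
  have hv := vC j a c n k hk hn
  have h := pcoef_L2 (2 * j) (fC j a c) (n - k) k n (by omega) (by linarith)
  generalize ugen j a c n * pcoef (2 * j) (fC j a c) (n - 1) k = v at *
  have z1 : (2 * (j : ℝ) - 2 * n - 1) ≠ 0 := by intro h; linarith
  have z2 : (2 * (j : ℝ) - 2 * n) ≠ 0 := by intro h; linarith
  have z3 : (n : ℝ) + 1 - k ≠ 0 := by intro h; linarith
  have z4 : (j : ℝ) - n ≠ 0 := by intro h; linarith
  have z5 : 2 * (j : ℝ) - n + 1 - k ≠ 0 := by intro h; linarith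
  have z9 : (j : ℝ) * 2 - n + 1 - k ≠ 0 := by intro h; linarith
  have z6 : (2 * (j : ℝ) - 2 * n + 1) ≠ 0 := by intro h; linarith
  generalize pcoef _ _ (n + 1) k = q at *
  generalize pcoef _ _ n k = p at *
  simp only [fC, bEven] at h hT ⊢
  have hq : q = (n + 1) * ((c + a + n) * (c - a - j + n) * (n + 1 - j)) * (2 * j - n - k) * p
      / ((n + 1 - k) * (2 * j - 2 * n) * (2 * j - 2 * n - 1)) := by
    rw [eq_div_iff (by positivity)]; linear_combination h
  have hT' : T = k * ((c + a + (k - 1)) * (c - a - j + (k - 1)) * (k - 1 + 1 - j)) * p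
      / ((n + 1 - k) * (2 * j - n + 1 - k)) := by
    rw [eq_div_iff (by positivity)]; linear_combination hT
  have hv' : v = (n - k) * (2 * j - n + 1) * (c - a + j - n) * (a + c + 2 * j - n)
      * (j + 1 - n) * p
      / (2 * (2 * j - 2 * n + 1) * (j - n) * (2 * j - n + 1 - k)) := by
    field_simp; field_simp at hv; linear_combination hv
  rw [hq, hT', hv', show 2 * (n : ℝ) + 1 - 2 * j = -(2 * (j : ℝ) - 2 * n - 1) by ring,
    show 2 * (n : ℝ) - 1 - 2 * j = -(2 * (j : ℝ) - 2 * n + 1) by ring,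
    show 2 * (j : ℝ) - 2 * n = 2 * (j - n) by ring] at *
  field_simp
  ring

lemma relR (j : ℕ) (a c : ℝ) (k : ℕ) (hk : k ≤ j) (T : ℝ)
    (hT : ((j : ℝ) - k + 1) * (2 * j - j - k + 1) * T
      = k * fA j a c (k - 1) * pcoef (2 * j) (fA j a c) j k) :
    0 = T - ((a + k) ^ 2 + bEven j a c j)
      * pcoef (2 * j) (fA j a c) j k
      - 2 * ugen j a c j * pcoef (2 * j) (fA j a c) (j - 1) k := by
  have hk' : (k : ℝ) ≤ j := by exact_mod_cast hk
  have hv := vA j a c j k hk le_rfl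
  rw [mul_assoc 2]
  generalize ugen j a c j * pcoef (2 * j) (fA j a c) (j - 1) k = v at *
  have z3 : (j : ℝ) + 1 - k ≠ 0 := by intro h; linarith
  generalize pcoef _ _ j k = p at *
  simp only [fA, bEven] at hT ⊢
  have hT' : T = k * ((k - 1 - j) * (a + c + (k - 1)) * (a - c + 1 - j + (k - 1))) * p
      / ((j + 1 - k) * (j + 1 - k)) := by
    rw [eq_div_iff (by positivity)]; linear_combination hT
  have hv' : v = (j - k) * (j + 1) * (a - c + 1) * (a + c + j) * p
      / (2 * (j + 1 - k)) := by
    rw [eq_div_iff (by positivity)]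
    rw [show 2 * (j : ℝ) - 2 * j + 1 = 1 by ring] at hv
    linear_combination 2 * hv
  rw [hT', hv', show 2 * (j : ℝ) + 1 - 2 * j = 1 by ring,
    show 2 * (j : ℝ) - 1 - 2 * j = -1 by ring]
  field_simp
  ring

lemma expan_extend (e : ℝ) (N : ℝ) (f : ℝ → ℝ) (m n : ℕ) (h : m ≤ n) :
    expan e (pcoef N f m) n = expan e (pcoef N f m) m := by
  induction n, h using Nat.le_induction with
  | base => rfl
  | succ n hn ih =>
    rw [← ih, expan, expan, Finset.sum_range_succ _ (n + 1), pcoef_gt _ _ _ _ (by omega)]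
    simp

lemma ops_expan (j : ℕ) (a c α e : ℝ) (f : ℝ → ℝ)
    (H : ∀ n k : ℕ, k ≤ n → n < j → ∀ T : ℝ,
      ((n : ℝ) - k + 1) * (2 * j - n - k + 1) * T = k * f (k - 1) * pcoef (2 * j) f n k →
      pcoef (2 * j) f (n + 1) k = T - ((e + k) ^ 2 + bEven j a c n) * pcoef (2 * j) f n k
        - ugen j a c n * pcoef (2 * j) f (n - 1) k) :
    ∀ n ≤ j, (monicOPS (bEven j a c) (uEven j a c α) n).2 = expan e (pcoef (2 * j) f n) n := by
  intro n
  induction n using Nat.strong_induction_on with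
  | _ n ih =>
  intro hn
  rcases n with _ | n
  · simp [monicOPS, expan, pcoef, qbasis]
  have hn' : (n : ℝ) + 1 ≤ j := by exact_mod_cast hn
  have h := pcoef_rel (2 * j) e (bEven j a c n) (ugen j a c n) f (pcoef (2 * j) f (n + 1))
    (pcoef (2 * j) f (n - 1)) n (by linarith) (pcoef_self _ _ _) (pcoef_gt _ _ _ _ (by omega))
    (fun k hk T hT => H n k hk (by omega) T hT)
  rw [h, monicOPS, ih n (by omega) (by omega), uEven_generic _ _ _ _ _ (by omega),
    expan_extend _ _ _ (n - 1) (n + 1) (by omega)]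
  rcases n with _ | n
  · simp [ugen]
  · rw [← ih (n + 1 - 1) (by omega) (by omega)]; rfl

theorem paraRacahEven_characteristic_poly (j : ℕ) (hj : 1 ≤ j) (a c α : ℝ) :
    paraRacahEven j a c α (2 * j + 1) =
      (∏ s ∈ Finset.range (j + 1), (X + C ((a + s) ^ 2))) *
        ∏ s ∈ Finset.range j, (X + C ((c + s) ^ 2)) := by
  have hA := ops_expan j a c α a (fA j a c) (relA j a c)
  have hC := ops_expan j a c α c (fC j a c) (relC j a c)
  have hP : (monicOPS (bEven j a c) (uEven j a c α) j).2 = qbasis c j := by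
    rw [hC j le_rfl, expan, Finset.sum_range_succ, pcoef_self, Finset.sum_eq_zero]
    · simp
    · intro k hk
      have hk := Finset.mem_range.1 hk
      rw [pcoef, Finset.prod_eq_zero (i := j - 1) (by simp; omega)]
      · simp
      · rw [fC, Nat.cast_sub hj]; simp
  have hR := pcoef_rel (2 * j) a (bEven j a c j) (2 * ugen j a c j) (fA j a c)
    (fun k => if k = j + 1 then 1 else 0) (pcoef (2 * j) (fA j a c) (j - 1)) j le_rfl (by simp)
    (pcoef_gt _ _ _ _ (by omega))
    (fun k hk T hT => by rw [if_neg (by omega)]; exact relR j a c k hk T hT)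
  rw [expan_extend _ _ _ (j - 1) (j + 1) (by omega), ← hA j le_rfl, ← hA (j - 1) (by omega)] at hR
  have hE : expan a (fun k => if k = j + 1 then 1 else 0) (j + 1) = qbasis a (j + 1) := by
    rw [expan, Finset.sum_eq_single (j + 1)]
    · simp
    · intro b _ hb; simp [hb]
    · simp
  rw [hE] at hR
  have hM := mirror (bEven j a c) (uEven j a c α) j (bEven_mirror j a c) (uEven_mirror j a c α)
    j le_rfl (j + 1) (by omega)
  have hu : 2 * ugen j a c j = uEven j a c α j + uEven j a c α (j + 1) := by
    simp only [uEven, ugen, if_true]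
    rw [if_neg (by omega), show 2 * (j : ℝ) - 2 * j + 1 = 1 by ring]
    ring
  have h1 : (monicOPS (bEven j a c) (uEven j a c α) j).1
      = (monicOPS (bEven j a c) (uEven j a c α) (j - 1)).2 := by
    obtain ⟨i, rfl⟩ : ∃ i, j = i + 1 := ⟨j - 1, by omega⟩
    rfl
  change _ = qbasis a (j + 1) * qbasis c j
  rw [paraRacahEven, hM, hR, ← hP, hu, ← h1, monicOPS, C_add]
  ring
end
end
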